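/- arXiv:0907.2071 — 2 statements merged into one kernel-verified Lean document; each statement's English description precedes it below -/
import Mathlib

section
/- Let α be a type with decidable equality, let m be a natural number, and define the LRU update step : List α → α → List α by step q a = (a :: q.erase a).take m. Then for every access sequence X : List α, X.foldl step [] equals the list of distinct elements of X ordered from most recently accessed to least recently accessed (i.e., X.dedup.reverse, where dedup retains the last occurrence of each element in chronological order), truncated to its first m entries: X.foldl step [] = (X.dedup.reverse).take m. -/
theorem lru_take_erase {α : Type*} [DecidableEq α] (a : α) (L : List α) : ∀ k : ℕ,
    ((L.take (k+1)).erase a).take k = (L.erase a).take k := by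
  induction L with
  | nil => intro k; simp
  | cons b L ih =>
    intro k
    by_cases h : b = a
    · subst h; simp [List.take_take]
    · cases k with
      | zero => simp
      | succ k =>
        have h1 : (b == a) = false := by simpa using h
        rw [List.take_succ_cons, List.erase_cons, List.erase_cons]
        simp only [h1, Bool.false_eq_true, if_false, List.take_succ_cons, ih k]

theorem lru_dedup_concat {α : Type*} [DecidableEq α] (a : α) (X : List α) :
    (X ++ [a]).dedup = X.dedup.filter (fun x => x ≠ a) ++ [a] := by
  induction X with
  | nil => simp
  | cons b X ih =>
    rw [List.cons_append, List.dedup_cons, List.dedup_cons, ih]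
    by_cases h : b = a <;> by_cases h2 : b ∈ X <;> simp_all

/-- LRU queue of capacity `m`: the fold of the update step
`step q a = (a :: q.erase a).take m` over an access sequence `X` yields the
distinct elements of `X` ordered from most recently to least recently accessed
(`X.dedup` retains last occurrences in chronological order, so we reverse it),
truncated to the first `m` entries. -/
theorem lru_foldl_eq_dedup_reverse_take {α : Type*} [DecidableEq α] (m : ℕ) (X : List α) :
    X.foldl (fun q a => (a :: q.erase a).take m) [] = X.dedup.reverse.take m := by
  induction X using List.reverseRecOn with
  | nil => simp
  | append_singleton X a ih =>
    rw [List.foldl_append, ih, lru_dedup_concat]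
    simp only [List.foldl_cons, List.foldl_nil, List.reverse_append, List.reverse_singleton,
      List.singleton_append]
    cases m with
    | zero => simp
    | succ k =>
      rw [List.take_succ_cons, List.take_succ_cons, lru_take_erase,
        (List.nodup_reverse.2 X.nodup_dedup).erase_eq_filter, List.filter_reverse]
      congr 3
      apply List.filter_congr
      intro x _
      by_cases h : x = a <;> simp [h]
end

section
/- Let α be a type with decidable equality, let m be a natural number, and define step : List α → α → List α by step q a = (a :: q.erase a).take m. Suppose X : List α is an access sequence, x occurs in X, but x is not a member of the final queue X.foldl step []. Then the suffix of X strictly after the last occurrence of x contains at least m distinct elements; that is, if X = Y ++ (x :: Z) with x ∉ Z, then Z.toFinset.card ≥ m. -/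
/-- While fewer than `m` distinct elements have been accessed since `x`, the queue
holds `x`, preceded by distinct elements accessed since then. -/
lemma lru_invariant {α : Type*} [DecidableEq α] (m : ℕ) (q : List α) (x : α) (Z : List α) :
    x ∉ Z → Z.toFinset.card < m →
    ∃ A B : List α, (x :: Z).foldl (fun q a => (a :: q.erase a).take m) q = A ++ x :: B ∧
      A.Nodup ∧ A ⊆ Z := by
  induction Z using List.reverseRecOn with
  | nil =>
    intro _ hm
    obtain ⟨k, rfl⟩ : ∃ k, m = k + 1 := ⟨m - 1, by simp at hm; omega⟩
    exact ⟨[], (q.erase x).take k, by simp, by simp, by simp⟩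
  | append_singleton Z a ih =>
    intro hx hm
    have hxa : x ≠ a := by rintro rfl; simp at hx
    have hxZ : x ∉ Z := fun h => hx (by simp [h])
    have hle : Z.toFinset.card ≤ (Z ++ [a]).toFinset.card :=
      Finset.card_le_card (by intro y; simp; tauto)
    obtain ⟨A, B, hq, hA, hAZ⟩ := ih hxZ (by omega)
    have hB : ∃ B', (A ++ x :: B).erase a = A.erase a ++ x :: B' := by
      by_cases h : a ∈ A
      · exact ⟨B, List.erase_append_left _ h⟩
      · refine ⟨B.erase a, ?_⟩
        rw [List.erase_append_right _ h, List.erase_of_not_mem h,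
          List.erase_cons_tail (by simpa using hxa)]
    obtain ⟨B', hB'⟩ := hB
    have hnd : (a :: A.erase a).Nodup :=
      List.nodup_cons.2 ⟨hA.not_mem_erase, hA.erase a⟩
    have hsub : (a :: A.erase a) ⊆ Z ++ [a] := by
      intro y hy
      rcases List.mem_cons.1 hy with rfl | hy
      · simp
      · simp [hAZ (List.mem_of_mem_erase hy)]
    have hlen : (a :: A.erase a).length ≤ (Z ++ [a]).toFinset.card := by
      rw [← List.toFinset_card_of_nodup hnd]
      apply Finset.card_le_card
      intro y hy
      exact List.mem_toFinset.2 (hsub (List.mem_toFinset.1 hy))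
    obtain ⟨k, hk⟩ : ∃ k, m = (a :: A.erase a).length + (k + 1) :=
      ⟨m - (a :: A.erase a).length - 1, by omega⟩
    refine ⟨a :: A.erase a, B'.take k, ?_, hnd, hsub⟩
    rw [← List.cons_append, List.foldl_append, hq]
    simp only [List.foldl_cons, List.foldl_nil]
    rw [hB', ← List.cons_append, hk, List.take_length_add_append, List.take_succ_cons]


/-- If `x` occurs in the access sequence `X` but has been evicted from the
capacity-`m` LRU queue (i.e. `x` is not in `X.foldl step []` where
`step q a = (a :: q.erase a).take m`), then the suffix of `X` strictly after
the last occurrence of `x` contains at least `m` distinct elements. -/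
theorem lru_evicted_suffix_card {α : Type*} [DecidableEq α] (m : ℕ) (X Y Z : List α) (x : α)
    (hmem : x ∈ X)
    (hnot : x ∉ X.foldl (fun q a => (a :: q.erase a).take m) [])
    (hsplit : X = Y ++ x :: Z) (hxZ : x ∉ Z) :
    m ≤ Z.toFinset.card := by
  by_contra h
  obtain ⟨A, B, hq, -, -⟩ := lru_invariant m
    (Y.foldl (fun q a => (a :: q.erase a).take m) []) x Z hxZ (by omega)
  apply hnot
  rw [hsplit, List.foldl_append, hq]
  simp
end
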